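/- For x ∈ ℝ and k ∈ ℕ let (x)_k = ∏_{i=0}^{k−1}(x+i) denote the Pochhammer symbol, let C(n,k) be the binomial coefficient, and define for ε ∈ ℝ and natural numbers N, σ, j₀, j₁, j₂ the summand T(ε;N,σ,j₀,j₁,j₂) = C(j₀+1,j₂)·C(N−j₀−3,j₁)·(j₁+j₂+1)!·(j₁+j₂+2)!·(−1)^N·(ε/2+1)_σ·(−ε)_σ·(j₁+j₂+3)_σ·(3−ε/2)_{j₁}·(N−j₀−2)!·(N−j₁−j₂−2)! / (N!·(j₁+4)_σ·(j₁+j₂+4−ε/2)_σ·(4−ε/2)_{j₁+j₂}·σ!·(j₁+3)!·(N−j₀−3)!), and set U(ε,N) = Σ_{σ=0}^{∞} Σ_{j₀=0}^{N−3} Σ_{j₁=0}^{N−j₀−3} Σ_{j₂=0}^{j₀+1} T(ε;N,σ,j₀,j₁,j₂). Then for every integer N ≥ 3 the function ε ↦ U(ε,N) is differentiable at ε = 0 with derivative equal to ζ(2)·( −3(−1)^N(4N+3)/(2N) − 3(−1)^N(3N+2)·S_{−1}(N)/N + 9/(2N) ) + 3(−1)^N·S_1(N)²/(2(N+1)) +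 (−1)^N(2N⁴+34N³+101N²+89N+2)·S_1(N)/(2N(N+1)²(N+2)) + 3(−1)^N(4N²+14N+13)/((N+1)(N+2)) + (−1)^N(−30N²−38N+1)·S_2(N)/(2N(N+1)) − 9(−1)^N(2N+1)·S_3(N)/N + 9·S_{−2}(N)/N + 9(−1)^N·S_{2,1}(N) − 6(−1)^N(3N+2)·S_{−2}(N)·S_{−1}(N)/N + 6(−1)^N(3N+2)·S_{−2,−1}(N)/N, where ζ(2) = Σ_{i=1}^{∞} 1/i² = π²/6, S_a(N) = Σ_{k=1}^{N} sign(a)^k/k^{|a|} for a nonzero integer a, S_{2,1}(N) = Σ_{k=1}^{N} S_1(k)/k², and S_{−2,−1}(N) = Σ_{k=1}^{N} (−1)^k·S_{−1}(k)/k². -/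

import Mathlib

/-- The Pochhammer symbol `(x)_k = ∏_{i=0}^{k-1} (x+i)` for real `x`. -/
noncomputable def poch (x : ℝ) (k : ℕ) : ℝ := ∏ i ∈ Finset.range k, (x + (i : ℝ))

/-- The summand of the multi-sum (Ex-857), rewritten via factorials and Pochhammer
symbols. -/
noncomputable def T19 (ε : ℝ) (N σ j₀ j₁ j₂ : ℕ) : ℝ :=
  ((j₀ + 1).choose j₂ : ℝ) * ((N - j₀ - 3).choose j₁ : ℝ) *
      ((j₁ + j₂ + 1).factorial : ℝ) * ((j₁ + j₂ + 2).factorial : ℝ) * (-1 : ℝ) ^ N *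
      poch (ε / 2 + 1) σ * poch (-ε) σ * poch ((j₁ : ℝ) + (j₂ : ℝ) + 3) σ *
      poch (3 - ε / 2) j₁ * ((N - j₀ - 2).factorial : ℝ) *
      ((N - j₁ - j₂ - 2).factorial : ℝ) /
    ((N.factorial : ℝ) * poch ((j₁ : ℝ) + 4) σ *
      poch ((j₁ : ℝ) + (j₂ : ℝ) + 4 - ε / 2) σ * poch (4 - ε / 2) (j₁ + j₂) *
      (σ.factorial : ℝ) * ((j₁ + 3).factorial : ℝ) * ((N - j₀ - 3).factorial : ℝ))

/-- The multi-sum `U(ε,N)` of (Ex-857). -/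
noncomputable def U19 (ε : ℝ) (N : ℕ) : ℝ :=
  ∑' σ : ℕ, ∑ j₀ ∈ Finset.range (N - 2), ∑ j₁ ∈ Finset.range (N - j₀ - 2),
    ∑ j₂ ∈ Finset.range (j₀ + 2), T19 ε N σ j₀ j₁ j₂

/-- The harmonic sums `S_a(N) = ∑_{k=1}^{N} sign(a)^k / k^{|a|}`. -/
noncomputable def hS (a : ℤ) (N : ℕ) : ℝ :=
  ∑ k ∈ Finset.Icc 1 N, (if a < 0 then (-1 : ℝ) ^ k else 1) / (k : ℝ) ^ a.natAbs

/-- The nested harmonic sum `S_{2,1}(N) = ∑_{k=1}^{N} S_1(k)/k²`. -/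
noncomputable def hS21 (N : ℕ) : ℝ := ∑ k ∈ Finset.Icc 1 N, hS 1 k / (k : ℝ) ^ 2

/-- The nested harmonic sum `S_{-2,-1}(N) = ∑_{k=1}^{N} (-1)^k S_{-1}(k)/k²`. -/
noncomputable def hSm2m1 (N : ℕ) : ℝ :=
  ∑ k ∈ Finset.Icc 1 N, (-1 : ℝ) ^ k * hS (-1) k / (k : ℝ) ^ 2

/-! ### The Beta-type kernel and its series -/

/-- The kernel `n! s! / (s+1+n)!`, i.e. the Beta value `B(s+1, n+1)`. -/
noncomputable def betaKer (n s : ℕ) : ℝ :=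
  (n.factorial : ℝ) * (s.factorial : ℝ) / ((s + 1 + n).factorial : ℝ)

/-- The series `∑_{s ≥ 0} M B(s+1, n+1) / (s+1+M)`. -/
noncomputable def betaSum (n M : ℕ) : ℝ :=
  ∑' s : ℕ, (M : ℝ) * betaKer n s / ((s : ℝ) + 1 + M)

lemma hasSum_telescope {u : ℕ → ℝ} (hmono : ∀ s, u (s + 1) ≤ u s)
    (hu : Filter.Tendsto u Filter.atTop (nhds 0)) :
    HasSum (fun s => u s - u (s + 1)) (u 0) := by
  rw [hasSum_iff_tendsto_nat_of_nonneg (fun s => sub_nonneg.2 (hmono s))]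
  simp only [Finset.sum_range_sub']
  simpa using hu.const_sub (u 0)

lemma HasSum.of_eq {f g : ℕ → ℝ} {a b : ℝ} (h : HasSum f a) (hf : ∀ s, g s = f s)
    (ha : b = a) : HasSum g b := by
  rwa [ha, funext hf]

lemma betaKer_nonneg (n s : ℕ) : 0 ≤ betaKer n s := by
  unfold betaKer; positivity

lemma betaKer_succ_left (n s : ℕ) :
    betaKer (n + 1) s = betaKer n s * ((n : ℝ) + 1) / ((s : ℝ) + 2 + n) := by
  unfold betaKer
  rw [show s + 1 + (n + 1) = (s + 1 + n) + 1 by ring, Nat.factorial_succ, Nat.factorial_succ]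
  have : ((s + 1 + n).factorial : ℝ) ≠ 0 := by positivity
  have h2 : (s : ℝ) + 2 + n ≠ 0 := by positivity
  have h3 : (s : ℝ) + 1 + n + 1 ≠ 0 := by positivity
  push_cast
  field_simp
  ring

lemma betaKer_succ_right (n s : ℕ) :
    betaKer n (s + 1) = betaKer n s * ((s : ℝ) + 1) / ((s : ℝ) + 2 + n) := by
  unfold betaKer
  rw [show s + 1 + 1 + n = (s + 1 + n) + 1 by ring, Nat.factorial_succ, Nat.factorial_succ]
  have : ((s + 1 + n).factorial : ℝ) ≠ 0 := by positivity
  have h2 : (s : ℝ) + 2 + n ≠ 0 := by positivity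
  have h3 : (s : ℝ) + 1 + n + 1 ≠ 0 := by positivity
  push_cast
  field_simp
  ring

lemma betaKer_zero_left (s : ℕ) : betaKer 0 s = 1 / ((s : ℝ) + 1) := by
  unfold betaKer
  have : (s.factorial : ℝ) ≠ 0 := by positivity
  simp only [add_zero, Nat.factorial_succ, Nat.factorial_zero]
  push_cast
  field_simp

lemma betaKer_zero_right (n : ℕ) : betaKer n 0 = 1 / ((n : ℝ) + 1) := by
  unfold betaKer
  have : (n.factorial : ℝ) ≠ 0 := by positivity
  rw [show 0 + 1 + n = n + 1 by ring, Nat.factorial_succ, Nat.factorial_zero]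
  push_cast
  field_simp

lemma betaKer_le (n s : ℕ) : betaKer n s ≤ 1 / ((s : ℝ) + 1) := by
  induction n with
  | zero => exact (betaKer_zero_left s).le
  | succ n ih =>
    refine le_trans ?_ ih
    rw [betaKer_succ_left, div_le_iff₀ (by positivity)]
    exact mul_le_mul_of_nonneg_left (by linarith [(Nat.cast_nonneg s : (0 : ℝ) ≤ s)])
      (betaKer_nonneg n s)

lemma betaKer_antitone (n s : ℕ) : betaKer n (s + 1) ≤ betaKer n s := by
  rw [betaKer_succ_right, div_le_iff₀ (by positivity)]
  exact mul_le_mul_of_nonneg_left (by linarith [(Nat.cast_nonneg n : (0 : ℝ) ≤ n)])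
    (betaKer_nonneg n s)

lemma tendsto_betaKer (n : ℕ) : Filter.Tendsto (betaKer n) Filter.atTop (nhds 0) :=
  squeeze_zero (betaKer_nonneg n) (betaKer_le n) tendsto_one_div_add_atTop_nhds_zero_nat

lemma hasSum_betaKer_succ (n : ℕ) : HasSum (betaKer (n + 1)) (1 / ((n : ℝ) + 1)) := by
  rw [← betaKer_zero_right]
  convert hasSum_telescope (betaKer_antitone n) (tendsto_betaKer n) using 2 with s
  rw [betaKer_succ_left, betaKer_succ_right]
  have : (s : ℝ) + 2 + n ≠ 0 := by positivity
  field_simp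
  ring

lemma summable_inv_sq : Summable (fun s : ℕ => 1 / ((s : ℝ) + 1) ^ 2) := by
  have h := (summable_nat_add_iff 1).2 (Real.summable_one_div_nat_pow.2 (one_lt_two))
  simpa using h

lemma summable_betaKer_div (n M : ℕ) :
    Summable (fun s : ℕ => betaKer n s / ((s : ℝ) + 1 + M)) := by
  refine Summable.of_nonneg_of_le (fun s => ?_) (fun s => ?_) summable_inv_sq
  · have := betaKer_nonneg n s
    positivity
  · calc betaKer n s / ((s : ℝ) + 1 + M) ≤ (1 / ((s : ℝ) + 1)) / ((s : ℝ) + 1) := by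
          exact div_le_div₀ (by positivity) (betaKer_le n s) (by positivity)
            (le_add_of_nonneg_right M.cast_nonneg)
      _ = 1 / ((s : ℝ) + 1) ^ 2 := by rw [div_div, sq]

lemma hasSum_betaSum (n M : ℕ) :
    HasSum (fun s : ℕ => (M : ℝ) * betaKer n s / ((s : ℝ) + 1 + M)) (betaSum n M) := by
  have := ((summable_betaKer_div n M).mul_left (M : ℝ)).hasSum
  simpa only [mul_div_assoc, betaSum] using this

lemma betaSum_rec (n M : ℕ) :
    ((M : ℝ) - ((n : ℝ) + 1)) * betaSum (n + 1) M + ((n : ℝ) + 1) * betaSum n M =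
      M / ((n : ℝ) + 1) := by
  have h1 := ((hasSum_betaSum (n + 1) M).mul_left ((M : ℝ) - ((n : ℝ) + 1))).add
    ((hasSum_betaSum n M).mul_left ((n : ℝ) + 1))
  have h2 := (hasSum_betaKer_succ n).mul_left (M : ℝ)
  rw [show (M : ℝ) / ((n : ℝ) + 1) = M * (1 / ((n : ℝ) + 1)) by ring]
  refine h1.unique ?_
  convert h2 using 2 with s
  rw [betaKer_succ_left]
  have : (s : ℝ) + 2 + n ≠ 0 := by positivity
  have : (s : ℝ) + 1 + M ≠ 0 := by positivity
  field_simp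
  ring

lemma hS_succ (a : ℤ) (N : ℕ) :
    hS a (N + 1) =
      hS a N + (if a < 0 then (-1 : ℝ) ^ (N + 1) else 1) / ((N : ℝ) + 1) ^ a.natAbs := by
  unfold hS
  rw [Finset.sum_Icc_succ_top (by omega)]
  push_cast
  rfl

lemma hS_zero (a : ℤ) : hS a 0 = 0 := by simp [hS]

lemma hS_one_succ (N : ℕ) : hS 1 (N + 1) = hS 1 N + 1 / ((N : ℝ) + 1) := by
  simp [hS_succ]

lemma hS_two_succ (N : ℕ) : hS 2 (N + 1) = hS 2 N + 1 / ((N : ℝ) + 1) ^ 2 := by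
  simp [hS_succ]

lemma hS_three_succ (N : ℕ) : hS 3 (N + 1) = hS 3 N + 1 / ((N : ℝ) + 1) ^ 3 := by
  simp [hS_succ]

lemma hS_neg_one_succ (N : ℕ) :
    hS (-1) (N + 1) = hS (-1) N + (-1 : ℝ) ^ (N + 1) / ((N : ℝ) + 1) := by
  simp [hS_succ]

lemma hS_neg_two_succ (N : ℕ) :
    hS (-2) (N + 1) = hS (-2) N + (-1 : ℝ) ^ (N + 1) / ((N : ℝ) + 1) ^ 2 := by
  simp [hS_succ]

lemma hS21_succ (N : ℕ) : hS21 (N + 1) = hS21 N + hS 1 (N + 1) / ((N : ℝ) + 1) ^ 2 := by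
  unfold hS21
  rw [Finset.sum_Icc_succ_top (by omega)]
  push_cast
  rfl

lemma hSm2m1_succ (N : ℕ) :
    hSm2m1 (N + 1) =
      hSm2m1 N + (-1 : ℝ) ^ (N + 1) * hS (-1) (N + 1) / ((N : ℝ) + 1) ^ 2 := by
  unfold hSm2m1
  rw [Finset.sum_Icc_succ_top (by omega)]
  push_cast
  rfl

lemma betaSum_zero_left (M : ℕ) : betaSum 0 M = hS 1 M := by
  have key : ∀ M : ℕ, HasSum (fun s : ℕ => (M : ℝ) * betaKer 0 s / ((s : ℝ) + 1 + M)) (hS 1 M) := by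
    intro M
    induction M with
    | zero => simp [hS_zero]
    | succ M ih =>
      have ht : Filter.Tendsto (fun s : ℕ => 1 / ((s : ℝ) + 1 + M)) Filter.atTop (nhds 0) := by
        refine squeeze_zero (fun s => by positivity) (fun s => ?_)
          tendsto_one_div_add_atTop_nhds_zero_nat
        exact one_div_le_one_div_of_le (by positivity) (le_add_of_nonneg_right M.cast_nonneg)
      have h := hasSum_telescope (u := fun s : ℕ => 1 / ((s : ℝ) + 1 + M)) (fun s => by
        push_cast; gcongr; linarith) ht
      rw [hS_one_succ]
      convert ih.add h using 1
      · funext s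
        rw [betaKer_zero_left]
        have h1 : (s : ℝ) + 1 + M ≠ 0 := by positivity
        have h2 : (s : ℝ) + 1 + 1 + M ≠ 0 := by positivity
        have h3 : (s : ℝ) + 1 + (M + 1) ≠ 0 := by positivity
        push_cast
        field_simp
        ring
      · push_cast; ring
  exact (key M).tsum_eq

lemma neg_one_pow_mul_self (N : ℕ) : (-1 : ℝ) ^ N * (-1 : ℝ) ^ N = 1 := by
  rw [← mul_pow]; simp

/-- The diagonal series `∑ B(s+1, n+1) / (s+1+n)` in terms of `ζ(2)` and `S_{-2}`. -/
lemma hasSum_betaKer_diag (n : ℕ) :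
    HasSum (fun s : ℕ => betaKer n s / ((s : ℝ) + 1 + n))
      ((-1 : ℝ) ^ n * (Real.pi ^ 2 / 6 + 2 * hS (-2) n)) := by
  induction n with
  | zero =>
    have h := (hasSum_nat_add_iff' 1).2 hasSum_zeta_two
    refine HasSum.of_eq h (fun s => ?_) ?_
    · rw [betaKer_zero_left]
      push_cast
      rw [add_zero, div_div, sq]
    · simp [hS_zero]
  | succ n ih =>
    have hmono : ∀ s : ℕ, betaKer n (s + 1) / (((s + 1 : ℕ) : ℝ) + 1 + n) ≤
        betaKer n s / ((s : ℝ) + 1 + n) := by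
      intro s
      have := betaKer_nonneg n s
      gcongr
      · exact betaKer_antitone n s
      · linarith
    have h := (hasSum_telescope (u := fun s : ℕ => betaKer n s / ((s : ℝ) + 1 + n)) hmono
      (summable_betaKer_div n n).tendsto_atTop_zero).add
        ((hasSum_betaKer_succ n).mul_left (1 / ((n : ℝ) + 1)))
    refine HasSum.of_eq (h.sub ih) (fun s => ?_) ?_
    · rw [betaKer_succ_left, betaKer_succ_right]
      have h1 : (s : ℝ) + 1 + n ≠ 0 := by positivity
      have h2 : (s : ℝ) + 2 + n ≠ 0 := by positivity
      have h3 : (s : ℝ) + 1 + 1 + n ≠ 0 := by positivity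
      have h4 : (s : ℝ) + 1 + (n + 1) ≠ 0 := by positivity
      push_cast
      field_simp
      ring
    · rw [hS_neg_two_succ, betaKer_zero_right, pow_succ]
      have hs := neg_one_pow_mul_self n
      have h1 : (n : ℝ) + 1 ≠ 0 := by positivity
      push_cast
      field_simp
      generalize (-1 : ℝ) ^ n = c at *
      linear_combination 12 * ((n : ℝ) + 1) * hs

lemma betaSum_self (n : ℕ) :
    betaSum n n = n * ((-1 : ℝ) ^ n * (Real.pi ^ 2 / 6 + 2 * hS (-2) n)) := by
  have := ((hasSum_betaKer_diag n).mul_left (n : ℝ)).tsum_eq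
  simpa only [mul_div_assoc, betaSum] using this

/-! ### Summing the kernel series over the finite indices -/

/-- The linear `ε`-coefficient attached to the finite indices `j` and `m = j₁ + j₂`. -/
noncomputable def epsCoeff (j m : ℕ) : ℝ :=
  -(1 / 2) * (hS 1 (j + 2) - hS 1 (m + 3) + 1 / 3) - betaSum (j + 3) (m + 3)

lemma sum_weight_mul_harmonic (c : ℝ) (K : ℕ) :
    ∑ j ∈ Finset.range K, ((j : ℝ) + 1) / ((j : ℝ) + 3) * (hS 1 (j + 2) + c) =
      ((K : ℝ) + 2) * hS 1 (K + 2) - ((K : ℝ) + 2) - (hS 1 (K + 2) ^ 2 - hS 2 (K + 2)) +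
        c * ((K : ℝ) + 2 - 2 * hS 1 (K + 2)) + c := by
  induction K with
  | zero =>
    simp only [Finset.range_zero, Finset.sum_empty, hS_one_succ, hS_two_succ, hS_zero]
    norm_num
  | succ K ih =>
    rw [Finset.sum_range_succ, ih, show K + 1 + 2 = (K + 2) + 1 by ring, hS_one_succ (K + 2),
      hS_two_succ (K + 2)]
    have h : (K : ℝ) + 3 ≠ 0 := by positivity
    have h' : (K : ℝ) + 2 + 1 ≠ 0 := by positivity
    push_cast
    field_simp
    ring

lemma sum_weight_mul_betaSum (M : ℕ) (hM : 1 ≤ M) (K : ℕ) :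
    ∑ j ∈ Finset.range K, ((j : ℝ) + 1) / ((j : ℝ) + 3) * betaSum (j + 3) M =
      (M * hS 1 (K + 2) - hS 1 M + ((K : ℝ) + 3) * betaSum (K + 2) M) / ((M : ℝ) + 1) -
        2 * (hS 2 (K + 2) + (betaSum (K + 2) M - hS 1 M) / M) + betaSum 1 M := by
  have hM0 : (M : ℝ) ≠ 0 := by positivity
  have hM1 : (M : ℝ) + 1 ≠ 0 := by positivity
  induction K with
  | zero =>
    have h0 := betaSum_rec 0 M
    have h1 := betaSum_rec 1 M
    rw [betaSum_zero_left] at h0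
    simp only [Finset.range_zero, Finset.sum_empty, hS_one_succ 1, hS_one_succ 0, hS_two_succ 1,
      hS_two_succ 0, hS_zero, zero_add] at *
    norm_num at *
    field_simp
    field_simp at h1
    linear_combination (-8) * ((M : ℝ) + 2) * h0 - 4 * h1
  | succ K ih =>
    have h := betaSum_rec (K + 2) M
    rw [Finset.sum_range_succ, ih, show K + 1 + 2 = (K + 2) + 1 by ring, hS_one_succ (K + 2),
      hS_two_succ (K + 2)]
    rw [show K + 3 = K + 2 + 1 by ring]
    have h3 : (K : ℝ) + 3 ≠ 0 := by positivity
    have h4 : (K : ℝ) + 2 + 1 = (K : ℝ) + 3 := by ring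
    push_cast at *
    rw [h4] at *
    field_simp
    field_simp at h
    linear_combination (M * ((K : ℝ) + 3) - 2 * ((M : ℝ) + 1)) * h

lemma sum_weight_mul_epsCoeff (m : ℕ) :
    ∑ j ∈ Finset.range (m + 1), ((j : ℝ) + 1) / ((j : ℝ) + 3) * epsCoeff j m =
      -(1 / 2) * (hS 1 (m + 3) ^ 2 + hS 2 (m + 3) - 2 * ((m : ℝ) + 3) / 3 -
          5 * hS 1 (m + 3) / 3 + 1 / 3) -
        (((m : ℝ) + 1) * ((-1 : ℝ) ^ (m + 3) * (Real.pi ^ 2 / 6 + 2 * hS (-2) (m + 3))) +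
          ((m : ℝ) + 2) * hS 1 (m + 3) / ((m : ℝ) + 4) - 2 * hS 2 (m + 3) +
          2 * hS 1 (m + 3) / ((m : ℝ) + 3) +
          ((m : ℝ) + 3 - hS 1 (m + 3)) / ((m : ℝ) + 2)) := by
  have h1 : ∀ j ∈ Finset.range (m + 1), ((j : ℝ) + 1) / ((j : ℝ) + 3) * epsCoeff j m =
      -(1 / 2) * (((j : ℝ) + 1) / ((j : ℝ) + 3) * (hS 1 (j + 2) + (1 / 3 - hS 1 (m + 3)))) -
        ((j : ℝ) + 1) / ((j : ℝ) + 3) * betaSum (j + 3) (m + 3) := by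
    intro j _
    unfold epsCoeff
    ring
  rw [Finset.sum_congr rfl h1, Finset.sum_sub_distrib, ← Finset.mul_sum,
    sum_weight_mul_harmonic, sum_weight_mul_betaSum _ (by omega),
    show m + 1 + 2 = m + 3 by ring, betaSum_self]
  have h0 := betaSum_rec 0 (m + 3)
  rw [betaSum_zero_left] at h0
  have h2 : (m : ℝ) + 2 ≠ 0 := by positivity
  have hb : betaSum 1 (m + 3) = ((m : ℝ) + 3 - hS 1 (m + 3)) / ((m : ℝ) + 2) := by
    rw [eq_div_iff h2]
    push_cast at h0
    linear_combination h0
  rw [hb]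
  have h3 : (m : ℝ) + 3 ≠ 0 := by positivity
  have h4 : (m : ℝ) + 4 ≠ 0 := by positivity
  have h4' : (m : ℝ) + 3 + 1 ≠ 0 := by positivity
  push_cast
  field_simp
  ring

lemma sum_epsCoeff_triangle (K : ℕ) :
    ∑ m ∈ Finset.range K, 1 / (((m : ℝ) + 2) * ((m : ℝ) + 3)) *
        ∑ j ∈ Finset.range (m + 1), ((j : ℝ) + 1) / ((j : ℝ) + 3) * epsCoeff j m =
      Real.pi ^ 2 / 6 *
          (2 * (-1 : ℝ) ^ (K + 1) / ((K : ℝ) + 2) - 2 - 3 * hS (-1) (K + 1)) +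
        4 * (-1 : ℝ) ^ (K + 1) * hS (-2) (K + 1) / ((K : ℝ) + 2) -
        6 * hS (-2) (K + 1) * hS (-1) (K + 1) + 6 * hSm2m1 (K + 1) - 6 * hS 3 (K + 1) +
        3 * hS21 (K + 1) -
        (10 * ((K : ℝ) + 1) + 13) / (2 * ((K : ℝ) + 2)) * hS 2 (K + 1) +
        (2 * ((K : ℝ) + 1) ^ 3 + 33 * ((K : ℝ) + 1) ^ 2 + 97 * ((K : ℝ) + 1) + 84) /
          (6 * ((K : ℝ) + 2) ^ 2 * ((K : ℝ) + 3)) * hS 1 (K + 1) +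
        hS 1 (K + 1) ^ 2 / (2 * ((K : ℝ) + 2)) +
        (4 * ((K : ℝ) + 1) ^ 2 + 14 * ((K : ℝ) + 1) + 13) / (((K : ℝ) + 2) * ((K : ℝ) + 3)) -
        (10 * ((K : ℝ) + 2) ^ 2 + 11 * ((K : ℝ) + 2) + 18) / (6 * ((K : ℝ) + 2) ^ 3) := by
  induction K with
  | zero =>
    simp only [Finset.range_zero, Finset.sum_empty, zero_add, hS_one_succ 0, hS_two_succ 0,
      hS_three_succ 0, hS_neg_one_succ 0, hS_neg_two_succ 0, hS21_succ 0, hSm2m1_succ 0, hS_zero]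
    simp only [hS21, hSm2m1]
    norm_num
  | succ K ih =>
    rw [Finset.sum_range_succ, ih, sum_weight_mul_epsCoeff,
      show K + 3 = K + 1 + 1 + 1 by ring]
    simp only [hS_one_succ (K + 1 + 1), hS_two_succ (K + 1 + 1), hS_neg_two_succ (K + 1 + 1),
      hS21_succ (K + 1), hSm2m1_succ (K + 1), hS_three_succ (K + 1), hS_one_succ (K + 1),
      hS_two_succ (K + 1), hS_neg_two_succ (K + 1), hS_neg_one_succ (K + 1)]
    have hs := neg_one_pow_mul_self (K + 1)
    rw [pow_succ _ (K + 1 + 1), pow_succ _ (K + 1)]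
    generalize (-1 : ℝ) ^ (K + 1) = s at *
    generalize hS 1 (K + 1) = a1
    generalize hS 2 (K + 1) = a2
    generalize hS 3 (K + 1) = a3
    generalize hS (-1) (K + 1) = b1
    generalize hS (-2) (K + 1) = b2
    generalize hS21 (K + 1) = c1
    generalize hSm2m1 (K + 1) = c2
    generalize Real.pi ^ 2 / 6 = z
    push_cast
    have e2 : (K : ℝ) + 1 + 1 = K + 2 := by ring
    have e3 : (K : ℝ) + 2 + 1 = K + 3 := by ring
    have e4 : (K : ℝ) + 1 + 2 = K + 3 := by ring
    have e5 : (K : ℝ) + 1 + 3 = K + 4 := by ring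
    simp only [e2, e3, e4, e5]
    have h2 : (K : ℝ) + 2 ≠ 0 := by positivity
    have h3 : (K : ℝ) + 3 ≠ 0 := by positivity
    have h4 : (K : ℝ) + 4 ≠ 0 := by positivity
    have hs' : s ^ 2 = 1 := by rw [sq, hs]
    field_simp
    ring_nf
    simp only [hs']
    ring

lemma sum_epsCoeff_diag (K : ℕ) :
    ∑ m ∈ Finset.range K, ((m : ℝ) + 1) / ((m : ℝ) + 3) ^ 2 * epsCoeff m m =
      -hS 1 (K + 1) / 6 - hS 2 (K + 1) / 6 + 3 * hS 3 (K + 1) +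
        Real.pi ^ 2 / 6 * ((3 - (-1 : ℝ) ^ (K + 1)) / 2 +
          (-1 : ℝ) ^ (K + 1) * K / ((K : ℝ) + 2) + 2 * hS (-1) (K + 1)) -
        (-1 : ℝ) ^ (K + 1) * hS (-2) (K + 1) +
        2 * (-1 : ℝ) ^ (K + 1) * K / ((K : ℝ) + 2) * hS (-2) (K + 1) +
        4 * hS (-1) (K + 1) * hS (-2) (K + 1) - 4 * hSm2m1 (K + 1) -
        ((K : ℝ) + 1) * (10 * ((K : ℝ) + 2) ^ 2 + 11 * ((K : ℝ) + 2) + 18) /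
          (6 * ((K : ℝ) + 2) ^ 3) := by
  induction K with
  | zero =>
    simp only [Finset.range_zero, Finset.sum_empty, zero_add, hS_one_succ 0, hS_two_succ 0,
      hS_three_succ 0, hS_neg_one_succ 0, hS_neg_two_succ 0, hSm2m1_succ 0, hS_zero]
    simp only [hSm2m1]
    norm_num
  | succ K ih =>
    rw [Finset.sum_range_succ, ih, epsCoeff, betaSum_self,
      show K + 3 = K + 1 + 1 + 1 by ring, show K + 2 = K + 1 + 1 by ring]
    simp only [hS_one_succ (K + 1 + 1), hS_neg_two_succ (K + 1 + 1),
      hSm2m1_succ (K + 1), hS_three_succ (K + 1), hS_one_succ (K + 1),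
      hS_two_succ (K + 1), hS_neg_two_succ (K + 1), hS_neg_one_succ (K + 1)]
    have hs := neg_one_pow_mul_self (K + 1)
    rw [pow_succ _ (K + 1 + 1), pow_succ _ (K + 1)]
    generalize (-1 : ℝ) ^ (K + 1) = s at *
    generalize hS 1 (K + 1) = a1
    generalize hS 2 (K + 1) = a2
    generalize hS 3 (K + 1) = a3
    generalize hS (-1) (K + 1) = b1
    generalize hS (-2) (K + 1) = b2
    generalize hSm2m1 (K + 1) = c2
    generalize Real.pi ^ 2 / 6 = z
    push_cast
    have e2 : (K : ℝ) + 1 + 1 = K + 2 := by ring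
    have e3 : (K : ℝ) + 2 + 1 = K + 3 := by ring
    have e4 : (K : ℝ) + 1 + 2 = K + 3 := by ring
    simp only [e2, e3, e4]
    have h2 : (K : ℝ) + 2 ≠ 0 := by positivity
    have h3 : (K : ℝ) + 3 ≠ 0 := by positivity
    have hs' : s ^ 2 = 1 := by rw [sq, hs]
    field_simp
    ring_nf
    simp only [hs']
    ring

/-! ### Collapsing the triple finite sum -/

lemma sum_choose_mul_choose (a : ℕ) (n b : ℕ) :
    ∑ i ∈ Finset.range (n + 1), i.choose a * (n - i).choose b = (n + 1).choose (a + b + 1) := by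
  induction n generalizing b with
  | zero => cases a <;> cases b <;> simp <;> exact (Nat.choose_eq_zero_of_lt (by omega)).symm
  | succ n ih =>
    rw [Finset.sum_range_succ]
    cases b with
    | zero =>
      have h := ih 0
      simp only [Nat.choose_zero_right, mul_one, add_zero] at h ⊢
      rw [h, Nat.choose_succ_succ' (n + 1) a, add_comm]
    | succ b =>
      have h : ∀ i ∈ Finset.range (n + 1), i.choose a * (n + 1 - i).choose (b + 1) =
          i.choose a * (n - i).choose b + i.choose a * (n - i).choose (b + 1) := by
        intro i hi
        rw [Nat.sub_add_comm (Nat.lt_succ_iff.1 (Finset.mem_range.1 hi)), Nat.choose_succ_succ']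
        ring
      rw [Finset.sum_congr rfl h, Finset.sum_add_distrib, ih, ih, Nat.sub_self,
        Nat.choose_zero_succ, mul_zero, add_zero, ← add_assoc a b 1,
        Nat.choose_succ_succ' (n + 1) (a + b + 1)]

lemma sum_choose_mul_choose_mul (k a b : ℕ) :
    ∑ i ∈ Finset.range (k + 1),
        ((i + 1).choose a : ℝ) * ((k - i).choose b : ℝ) * ((k - i + 1 : ℕ) : ℝ) =
      ((b : ℝ) + 1) * (((k + 3).choose (a + b + 2) : ℝ) -
        if a = 0 then ((k + 2).choose (b + 1) : ℝ) else 0) := by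
  have h := sum_choose_mul_choose a (k + 2) (b + 1)
  rw [Finset.sum_range_succ, Finset.sum_range_succ', Nat.sub_self, Nat.choose_zero_succ,
    mul_zero, add_zero, Nat.sub_zero] at h
  have h' := congrArg (fun x : ℕ => (x : ℝ)) h
  simp only [Nat.cast_add, Nat.cast_sum, Nat.cast_mul] at h'
  have hterm : ∀ i ∈ Finset.range (k + 1),
      ((i + 1).choose a : ℝ) * ((k - i).choose b : ℝ) * ((k - i + 1 : ℕ) : ℝ) =
        ((b : ℝ) + 1) * (((i + 1).choose a : ℝ) * ((k + 2 - (i + 1)).choose (b + 1) : ℝ)) := by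
    intro i hi
    have hi' := Finset.mem_range.1 hi
    rw [show k + 2 - (i + 1) = k - i + 1 by omega]
    have e := congrArg (fun x : ℕ => (x : ℝ)) (Nat.add_one_mul_choose_eq (k - i) b)
    push_cast at e ⊢
    linear_combination ((i + 1).choose a : ℝ) * e
  rw [Finset.sum_congr rfl hterm, ← Finset.mul_sum]
  have hz : ((Nat.choose 0 a : ℕ) : ℝ) * ((k + 2).choose (b + 1) : ℝ) =
      if a = 0 then ((k + 2).choose (b + 1) : ℝ) else 0 := by
    cases a <;> simp
  rw [← hz, show a + b + 2 = a + (b + 1) + 1 by ring]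
  rw [show k + 3 = k + 2 + 1 by ring]
  linear_combination ((b : ℝ) + 1) * h'

lemma sum_triple_eq_sum_double (k : ℕ) (Φ : ℕ → ℕ → ℝ) :
    ∑ j₀ ∈ Finset.range (k + 1), ∑ j₁ ∈ Finset.range (k + 1 - j₀), ∑ j₂ ∈ Finset.range (j₀ + 2),
        ((j₀ + 1).choose j₂ : ℝ) * ((k - j₀).choose j₁ : ℝ) * ((k - j₀ + 1 : ℕ) : ℝ) * Φ j₁ j₂ =
      ∑ j₁ ∈ Finset.range (k + 2), ∑ j₂ ∈ Finset.range (k + 2),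
        ((j₁ : ℝ) + 1) * (((k + 3).choose (j₁ + j₂ + 2) : ℝ) -
          if j₂ = 0 then ((k + 2).choose (j₁ + 1) : ℝ) else 0) * Φ j₁ j₂ := by
  have hext : ∀ j₀ ∈ Finset.range (k + 1),
      ∑ j₁ ∈ Finset.range (k + 1 - j₀), ∑ j₂ ∈ Finset.range (j₀ + 2),
        ((j₀ + 1).choose j₂ : ℝ) * ((k - j₀).choose j₁ : ℝ) * ((k - j₀ + 1 : ℕ) : ℝ) * Φ j₁ j₂ =
      ∑ j₁ ∈ Finset.range (k + 2), ∑ j₂ ∈ Finset.range (k + 2),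
        ((j₀ + 1).choose j₂ : ℝ) * ((k - j₀).choose j₁ : ℝ) * ((k - j₀ + 1 : ℕ) : ℝ) * Φ j₁ j₂ := by
    intro j₀ hj₀
    have hj := Finset.mem_range.1 hj₀
    have hinner : ∀ j₁, ∑ j₂ ∈ Finset.range (j₀ + 2),
        ((j₀ + 1).choose j₂ : ℝ) * ((k - j₀).choose j₁ : ℝ) * ((k - j₀ + 1 : ℕ) : ℝ) * Φ j₁ j₂ =
        ∑ j₂ ∈ Finset.range (k + 2),
        ((j₀ + 1).choose j₂ : ℝ) * ((k - j₀).choose j₁ : ℝ) * ((k - j₀ + 1 : ℕ) : ℝ) *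
          Φ j₁ j₂ := by
      intro j₁
      refine Finset.sum_subset (Finset.range_subset_range.2 (by omega)) fun j₂ _ h => ?_
      rw [Finset.mem_range, not_lt] at h
      rw [Nat.choose_eq_zero_of_lt (by omega : j₀ + 1 < j₂)]
      simp
    simp only [hinner]
    refine Finset.sum_subset (Finset.range_subset_range.2 (by omega)) fun j₁ _ h => ?_
    rw [Finset.mem_range, not_lt] at h
    rw [Nat.choose_eq_zero_of_lt (by omega : k - j₀ < j₁)]
    simp
  rw [Finset.sum_congr rfl hext, Finset.sum_comm]
  refine Finset.sum_congr rfl fun j₁ _ => ?_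
  rw [Finset.sum_comm]
  refine Finset.sum_congr rfl fun j₂ _ => ?_
  rw [← Finset.sum_mul, sum_choose_mul_choose_mul, add_comm j₂ j₁]

lemma sum_double_eq_triangle_sub_diag (k : ℕ) (ψ : ℕ → ℕ → ℝ) :
    ∑ j₁ ∈ Finset.range (k + 2), ∑ j₂ ∈ Finset.range (k + 2),
        ((j₁ : ℝ) + 1) * (((k + 3).choose (j₁ + j₂ + 2) : ℝ) -
          if j₂ = 0 then ((k + 2).choose (j₁ + 1) : ℝ) else 0) *
          (((j₁ + j₂ + 1).factorial : ℝ) * ((k + 1 - (j₁ + j₂)).factorial : ℝ) /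
            (((k + 3).factorial : ℝ) * ((j₁ : ℝ) + j₂ + 3) * ((j₁ : ℝ) + 3)) *
              ψ j₁ (j₁ + j₂)) =
      ∑ m ∈ Finset.range (k + 2), 1 / (((m : ℝ) + 2) * ((m : ℝ) + 3)) *
          ∑ j ∈ Finset.range (m + 1), ((j : ℝ) + 1) / ((j : ℝ) + 3) * ψ j m -
        1 / ((k : ℝ) + 3) *
          ∑ m ∈ Finset.range (k + 2), ((m : ℝ) + 1) / ((m : ℝ) + 3) ^ 2 * ψ m m := by
  simp only [mul_sub, sub_mul, Finset.sum_sub_distrib]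
  congr 1
  · have hcut : ∀ j₁ ∈ Finset.range (k + 2), ∑ j₂ ∈ Finset.range (k + 2),
        ((j₁ : ℝ) + 1) * ((k + 3).choose (j₁ + j₂ + 2) : ℝ) *
          (((j₁ + j₂ + 1).factorial : ℝ) * ((k + 1 - (j₁ + j₂)).factorial : ℝ) /
            (((k + 3).factorial : ℝ) * ((j₁ : ℝ) + j₂ + 3) * ((j₁ : ℝ) + 3)) *
              ψ j₁ (j₁ + j₂)) =
        ∑ j₂ ∈ Finset.range (k + 2 - j₁), 1 / (((j₁ + j₂ : ℕ) + 2 : ℝ) * ((j₁ + j₂ : ℕ) + 3)) *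
          (((j₁ : ℝ) + 1) / ((j₁ : ℝ) + 3) * ψ j₁ (j₁ + j₂)) := by
      intro j₁ _
      symm
      refine Finset.sum_subset_zero_on_sdiff (Finset.range_subset_range.2 (by omega))
        (fun j₂ h => ?_) (fun j₂ h => ?_)
      · rw [Finset.mem_sdiff, Finset.mem_range, Finset.mem_range] at h
        rw [Nat.choose_eq_zero_of_lt (by omega : k + 3 < j₁ + j₂ + 2)]
        simp
      · rw [Finset.mem_range] at h
        have hc := Nat.choose_mul_factorial_mul_factorial (by omega : j₁ + j₂ + 2 ≤ k + 3)
        rw [show k + 3 - (j₁ + j₂ + 2) = k + 1 - (j₁ + j₂) by omega,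
          show j₁ + j₂ + 2 = j₁ + j₂ + 1 + 1 by ring, Nat.factorial_succ] at hc
        have hc' := congrArg (fun x : ℕ => (x : ℝ)) hc
        push_cast at hc'
        rw [show j₁ + j₂ + 2 = j₁ + j₂ + 1 + 1 by ring]
        have hN : ((k + 3).factorial : ℝ) ≠ 0 := by positivity
        have h1 : (j₁ : ℝ) + j₂ + 2 ≠ 0 := by positivity
        have h2 : (j₁ : ℝ) + j₂ + 3 ≠ 0 := by positivity
        have h3 : (j₁ : ℝ) + 3 ≠ 0 := by positivity
        push_cast
        field_simp
        linear_combination (-ψ j₁ (j₁ + j₂)) * hc'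
    rw [Finset.sum_congr rfl hcut]
    have hflip := Finset.sum_range_diag_flip (k + 2) (fun j l => 1 / (((j + l : ℕ) + 2 : ℝ) *
      ((j + l : ℕ) + 3)) * (((j : ℝ) + 1) / ((j : ℝ) + 3) * ψ j (j + l)))
    rw [← hflip]
    refine Finset.sum_congr rfl fun m _ => ?_
    rw [Finset.mul_sum]
    refine Finset.sum_congr rfl fun j hj => ?_
    rw [Nat.add_sub_cancel' (Nat.lt_succ_iff.1 (Finset.mem_range.1 hj))]
  · rw [Finset.mul_sum]
    refine Finset.sum_congr rfl fun j hj => ?_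
    rw [Finset.sum_eq_single 0 (fun j₂ _ h => by simp [h]) (fun h => by simp at h)]
    have hj' := Finset.mem_range.1 hj
    have hc := Nat.choose_mul_factorial_mul_factorial (by omega : j + 1 ≤ k + 2)
    rw [show k + 2 - (j + 1) = k + 1 - j by omega] at hc
    have hc' := congrArg (fun x : ℕ => (x : ℝ)) hc
    push_cast at hc'
    rw [show k + 3 = (k + 2) + 1 by ring, Nat.factorial_succ (k + 2)]
    have hN : ((k + 2).factorial : ℝ) ≠ 0 := by positivity
    have h3 : (j : ℝ) + 3 ≠ 0 := by positivity
    have h4 : (k : ℝ) + 3 ≠ 0 := by positivity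
    have h5 : (k : ℝ) + 2 + 1 = k + 3 := by ring
    simp only [if_true, add_zero]
    push_cast
    rw [h5]
    field_simp
    linear_combination ((j : ℝ) + 3) * ψ j j * hc'

/-! ### The infinite sum and its derivative at `ε = 0` -/

lemma poch_succ (x : ℝ) (k : ℕ) : poch x (k + 1) = poch x k * (x + k) :=
  Finset.prod_range_succ _ _

lemma poch_zero (x : ℝ) : poch x 0 = 1 := Finset.prod_range_zero _

lemma poch_succ' (x : ℝ) (k : ℕ) : poch x (k + 1) = x * poch (x + 1) k := by
  unfold poch
  rw [Finset.prod_range_succ', mul_comm]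
  push_cast
  rw [add_zero]
  congr 1
  exact Finset.prod_congr rfl fun i _ => by ring

lemma poch_pos {x : ℝ} (hx : 0 < x) (k : ℕ) : 0 < poch x k :=
  Finset.prod_pos fun i _ => by positivity

lemma poch_nonneg {x : ℝ} (hx : 0 ≤ x) (k : ℕ) : 0 ≤ poch x k :=
  Finset.prod_nonneg fun i _ => by positivity

lemma poch_mono {x y : ℝ} (hx : 0 ≤ x) (hxy : x ≤ y) (k : ℕ) : poch x k ≤ poch y k :=
  Finset.prod_le_prod (fun i _ => by positivity) fun i _ => by linarith

lemma continuous_poch (k : ℕ) : Continuous fun x : ℝ => poch x k :=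
  continuous_finsetProd _ fun i _ => by fun_prop

lemma poch_nat (a k : ℕ) : poch ((a : ℝ) + 1) k = ((a + k).factorial : ℝ) / (a.factorial : ℝ) := by
  have ha : (a.factorial : ℝ) ≠ 0 := by positivity
  induction k with
  | zero => rw [poch_zero, add_zero, div_self ha]
  | succ k ih =>
    rw [poch_succ, ih, ← add_assoc, Nat.factorial_succ]
    push_cast
    field_simp
    ring

lemma hasDerivAt_poch (a k : ℕ) :
    HasDerivAt (fun ε : ℝ => poch ((a : ℝ) + 1 - ε / 2) k)
      (-(1 / 2) * poch ((a : ℝ) + 1) k * (hS 1 (a + k) - hS 1 a)) 0 := by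
  induction k with
  | zero => simpa [poch_zero] using hasDerivAt_const (0 : ℝ) (1 : ℝ)
  | succ k ih =>
    have hlin : HasDerivAt (fun ε : ℝ => (a : ℝ) + 1 - ε / 2 + k) (-(1 / 2)) 0 := by
      simpa using (((hasDerivAt_id (0 : ℝ)).div_const 2).const_sub ((a : ℝ) + 1)).add_const (k : ℝ)
    have h := ih.fun_mul hlin
    simp only [poch_succ]
    refine h.congr_deriv ?_
    rw [← add_assoc, hS_one_succ]
    have : (a : ℝ) + k + 1 ≠ 0 := by positivity
    push_cast
    simp only [zero_div, sub_zero]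
    field_simp
    ring

lemma hasDerivAt_poch_div (j m : ℕ) :
    HasDerivAt (fun ε : ℝ => poch (3 - ε / 2) j / poch (4 - ε / 2) m)
      (poch 3 j / poch 4 m * (-(1 / 2) * (hS 1 (j + 2) - hS 1 (m + 3) + 1 / 3))) 0 := by
  have h1 := hasDerivAt_poch 2 j
  have h2 := hasDerivAt_poch 3 m
  norm_num only [Nat.cast_ofNat] at h1 h2
  have hp : poch 4 m ≠ 0 := (poch_pos (by norm_num) m).ne'
  have h := h1.fun_div h2 (by simpa using hp)
  refine h.congr_deriv ?_
  rw [add_comm 2 j, add_comm 3 m, hS_one_succ 2]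
  simp only [zero_div, sub_zero]
  field_simp
  push_cast
  ring

/-- The `σ`-dependent factor of the summand. -/
noncomputable def sigmaTerm (x y ε : ℝ) (σ : ℕ) : ℝ :=
  poch (ε / 2 + 1) σ * poch (-ε) σ * poch y σ /
    (poch x σ * poch (y + 1 - ε / 2) σ * (σ.factorial : ℝ))

/-- The shifted `σ`-dependent factor divided by `-ε`. -/
noncomputable def sigmaQuot (x y : ℝ) (σ : ℕ) (ε : ℝ) : ℝ :=
  poch (ε / 2 + 1) (σ + 1) * poch (1 - ε) σ * poch y (σ + 1) /
    (poch x (σ + 1) * poch (y + 1 - ε / 2) (σ + 1) * ((σ + 1).factorial : ℝ))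

lemma sigmaTerm_zero (x y ε : ℝ) : sigmaTerm x y ε 0 = 1 := by
  simp [sigmaTerm, poch_zero]

lemma sigmaTerm_succ (x y ε : ℝ) (σ : ℕ) :
    sigmaTerm x y ε (σ + 1) = -ε * sigmaQuot x y σ ε := by
  unfold sigmaTerm sigmaQuot
  rw [poch_succ' (-ε), show -ε + 1 = 1 - ε by ring]
  ring

lemma norm_sigmaQuot_le {x y : ℝ} (hx : 4 ≤ x) (hy : 0 < y) (σ : ℕ) {ε : ℝ}
    (hε : ε ∈ Set.Icc (-1 : ℝ) 1) : ‖sigmaQuot x y σ ε‖ ≤ 6 * (1 / ((σ : ℝ) + 1) ^ 2) := by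
  obtain ⟨h1, h2⟩ := hε
  have p1 : poch (ε / 2 + 1) (σ + 1) ≤ ((σ + 2).factorial : ℝ) := by
    have := poch_nat 1 (σ + 1)
    norm_num at this
    rw [show σ + 2 = 1 + (σ + 1) by ring, ← this]
    exact poch_mono (by linarith) (by linarith) _
  have p2 : poch (1 - ε) σ ≤ ((σ + 1).factorial : ℝ) := by
    have := poch_nat 1 σ
    norm_num at this
    rw [show σ + 1 = 1 + σ by ring, ← this]
    exact poch_mono (by linarith) (by linarith) _
  have p3 : ((σ + 4).factorial : ℝ) / 6 ≤ poch x (σ + 1) := by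
    have := poch_nat 3 (σ + 1)
    norm_num only [Nat.cast_ofNat, show Nat.factorial 3 = 6 from rfl] at this
    rw [show σ + 4 = 3 + (σ + 1) by ring, ← this]
    exact poch_mono (by norm_num) hx _
  have p4 : poch y (σ + 1) ≤ poch (y + 1 - ε / 2) (σ + 1) :=
    poch_mono hy.le (by linarith) _
  have q1 : 0 ≤ poch (ε / 2 + 1) (σ + 1) := poch_nonneg (by linarith) _
  have q2 : 0 ≤ poch (1 - ε) σ := poch_nonneg (by linarith) _
  have q4 : 0 < poch y (σ + 1) := poch_pos hy _
  have q5 : 0 < poch (y + 1 - ε / 2) (σ + 1) := q4.trans_le p4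
  have q3 : 0 < poch x (σ + 1) := poch_pos (by linarith) _
  unfold sigmaQuot
  rw [Real.norm_of_nonneg (by positivity)]
  calc _ ≤ ((σ + 2).factorial : ℝ) * ((σ + 1).factorial : ℝ) * poch (y + 1 - ε / 2) (σ + 1) /
        (((σ + 4).factorial : ℝ) / 6 * poch (y + 1 - ε / 2) (σ + 1) *
          ((σ + 1).factorial : ℝ)) := by gcongr
    _ = 6 * (1 / (((σ : ℝ) + 3) * ((σ : ℝ) + 4))) := by
      rw [show σ + 4 = σ + 2 + 1 + 1 by ring, Nat.factorial_succ (σ + 2 + 1),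
        Nat.factorial_succ (σ + 2)]
      have f1 : ((σ + 1).factorial : ℝ) ≠ 0 := by positivity
      have f2 : ((σ + 2).factorial : ℝ) ≠ 0 := by positivity
      have f3 : (σ : ℝ) + 3 ≠ 0 := by positivity
      have f4 : (σ : ℝ) + 4 ≠ 0 := by positivity
      have f5 : (σ : ℝ) + 2 + 1 = σ + 3 := by ring
      have f6 : (σ : ℝ) + 3 + 1 = σ + 4 := by ring
      generalize poch (y + 1 - ε / 2) (σ + 1) = p at *
      push_cast
      rw [f5, f6]
      field_simp
    _ ≤ _ := by
      refine mul_le_mul_of_nonneg_left (one_div_le_one_div_of_le (by positivity) ?_) (by norm_num)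
      nlinarith [(Nat.cast_nonneg σ : (0 : ℝ) ≤ σ)]

lemma continuousOn_sigmaQuot {x y : ℝ} (hx : 4 ≤ x) (hy : 0 < y) (σ : ℕ) :
    ContinuousOn (sigmaQuot x y σ) (Set.Icc (-1 : ℝ) 1) := by
  have hc : ∀ (k : ℕ) (f : ℝ → ℝ), Continuous f → Continuous fun ε => poch (f ε) k :=
    fun k f hf => (continuous_poch k).comp hf
  refine ContinuousOn.div (Continuous.continuousOn ?_) (Continuous.continuousOn ?_) ?_
  · exact ((hc _ _ (by fun_prop)).mul (hc _ _ (by fun_prop))).mul continuous_const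
  · exact (continuous_const.mul (hc _ _ (by fun_prop))).mul continuous_const
  · intro ε hε
    have h1 : 0 < poch (y + 1 - ε / 2) (σ + 1) := poch_pos (by linarith [hε.2]) _
    have h2 : 0 < poch x (σ + 1) := poch_pos (by linarith) _
    positivity

lemma summable_sigmaQuot {x y : ℝ} (hx : 4 ≤ x) (hy : 0 < y) {ε : ℝ}
    (hε : ε ∈ Set.Icc (-1 : ℝ) 1) : Summable fun σ => sigmaQuot x y σ ε :=
  Summable.of_norm_bounded (summable_inv_sq.mul_left 6) fun σ => norm_sigmaQuot_le hx hy σ hε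

lemma summable_sigmaTerm {x y : ℝ} (hx : 4 ≤ x) (hy : 0 < y) {ε : ℝ}
    (hε : ε ∈ Set.Icc (-1 : ℝ) 1) : Summable (sigmaTerm x y ε) := by
  rw [← summable_nat_add_iff 1]
  simp only [sigmaTerm_succ]
  exact (summable_sigmaQuot hx hy hε).mul_left _

lemma tsum_sigmaTerm {x y : ℝ} (hx : 4 ≤ x) (hy : 0 < y) {ε : ℝ}
    (hε : ε ∈ Set.Icc (-1 : ℝ) 1) :
    ∑' σ, sigmaTerm x y ε σ = 1 + -ε * ∑' σ, sigmaQuot x y σ ε := by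
  rw [(summable_sigmaTerm hx hy hε).tsum_eq_zero_add, sigmaTerm_zero]
  simp only [sigmaTerm_succ]
  rw [tsum_mul_left]

lemma hasDerivAt_tsum_sigmaTerm {x y : ℝ} (hx : 4 ≤ x) (hy : 0 < y) :
    HasDerivAt (fun ε => ∑' σ, sigmaTerm x y ε σ) (-∑' σ, sigmaQuot x y σ 0) 0 := by
  have hI : Set.Icc (-1 : ℝ) 1 ∈ nhds (0 : ℝ) := Icc_mem_nhds (by norm_num) (by norm_num)
  have hcont : ContinuousAt (fun ε => ∑' σ, sigmaQuot x y σ ε) 0 :=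
    (continuousOn_tsum (continuousOn_sigmaQuot hx hy) (summable_inv_sq.mul_left 6)
      fun σ ε hε => norm_sigmaQuot_le hx hy σ hε).continuousAt hI
  rw [hasDerivAt_iff_tendsto_slope_zero]
  refine Filter.Tendsto.congr' ?_ (hcont.tendsto.neg.mono_left nhdsWithin_le_nhds)
  filter_upwards [mem_nhdsWithin_of_mem_nhds hI, self_mem_nhdsWithin] with t ht ht0
  have ht0' : t ≠ 0 := ht0
  rw [zero_add, tsum_sigmaTerm hx hy ht, tsum_sigmaTerm hx hy (mem_of_mem_nhds hI), smul_eq_mul]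
  field_simp
  ring

lemma sigmaQuot_zero (n M σ : ℕ) (hM : 0 < M) :
    sigmaQuot ((n : ℝ) + 1) M σ 0 = (M : ℝ) * betaKer n σ / ((σ : ℝ) + 1 + M) := by
  unfold sigmaQuot betaKer
  have e1 := poch_nat 0 (σ + 1)
  have e2 := poch_nat 0 σ
  norm_num at e1 e2
  have hM' : (0 : ℝ) < M := by positivity
  have hp : poch ((M : ℝ) + 1) σ ≠ 0 := (poch_pos (by positivity) _).ne'
  have h1 : (M : ℝ) + 1 + σ ≠ 0 := by positivity
  have h2 : (σ : ℝ) + 1 + M ≠ 0 := by positivity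
  have f1 : ((σ + 1).factorial : ℝ) ≠ 0 := by positivity
  have f2 : (n.factorial : ℝ) ≠ 0 := by positivity
  have f3 : ((σ + 1 + n).factorial : ℝ) ≠ 0 := by positivity
  rw [zero_div, zero_add, sub_zero, sub_zero, e1, e2, poch_nat, poch_succ' (M : ℝ),
    poch_succ ((M : ℝ) + 1), add_comm n (σ + 1)]
  field_simp
  ring

lemma hasDerivAt_tsum_sigmaTerm_nat (n M : ℕ) (hn : 3 ≤ n) (hM : 0 < M) :
    HasDerivAt (fun ε => ∑' σ, sigmaTerm ((n : ℝ) + 1) M ε σ) (-betaSum n M) 0 := by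
  have hn' : (3 : ℝ) ≤ n := by exact_mod_cast hn
  have h := hasDerivAt_tsum_sigmaTerm (x := (n : ℝ) + 1) (y := M) (by linarith)
    (by exact_mod_cast hM)
  simp only [sigmaQuot_zero n M _ hM] at h
  exact h

/-- The factor of the summand that depends neither on `ε` nor on `σ`. -/
noncomputable def constFactor (N j₀ j₁ j₂ : ℕ) : ℝ :=
  ((j₀ + 1).choose j₂ : ℝ) * ((N - j₀ - 3).choose j₁ : ℝ) *
      ((j₁ + j₂ + 1).factorial : ℝ) * ((j₁ + j₂ + 2).factorial : ℝ) * (-1 : ℝ) ^ N *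
      ((N - j₀ - 2).factorial : ℝ) * ((N - j₁ - j₂ - 2).factorial : ℝ) /
    ((N.factorial : ℝ) * ((j₁ + 3).factorial : ℝ) * ((N - j₀ - 3).factorial : ℝ))

lemma T19_eq (ε : ℝ) (N σ j₀ j₁ j₂ : ℕ) :
    T19 ε N σ j₀ j₁ j₂ =
      constFactor N j₀ j₁ j₂ * (poch (3 - ε / 2) j₁ / poch (4 - ε / 2) (j₁ + j₂)) *
        sigmaTerm (((j₁ + 3 : ℕ) : ℝ) + 1) ((j₁ + j₂ + 3 : ℕ) : ℝ) ε σ := by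
  unfold T19 constFactor sigmaTerm
  have e1 : ((j₁ + 3 : ℕ) : ℝ) + 1 = (j₁ : ℝ) + 4 := by push_cast; ring
  have e2 : ((j₁ + j₂ + 3 : ℕ) : ℝ) + 1 - ε / 2 = (j₁ : ℝ) + j₂ + 4 - ε / 2 := by
    push_cast; ring
  have e3 : ((j₁ + j₂ + 3 : ℕ) : ℝ) = (j₁ : ℝ) + j₂ + 3 := by push_cast; ring
  rw [e2, e1, e3]
  ring

lemma U19_eq {ε : ℝ} (hε : ε ∈ Set.Icc (-1 : ℝ) 1) (N : ℕ) :
    U19 ε N = ∑ j₀ ∈ Finset.range (N - 2), ∑ j₁ ∈ Finset.range (N - j₀ - 2),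
      ∑ j₂ ∈ Finset.range (j₀ + 2),
        constFactor N j₀ j₁ j₂ * (poch (3 - ε / 2) j₁ / poch (4 - ε / 2) (j₁ + j₂)) *
          ∑' σ, sigmaTerm (((j₁ + 3 : ℕ) : ℝ) + 1) ((j₁ + j₂ + 3 : ℕ) : ℝ) ε σ := by
  have hs : ∀ j₀ j₁ j₂ : ℕ, Summable fun σ => T19 ε N σ j₀ j₁ j₂ := by
    intro j₀ j₁ j₂
    simp only [T19_eq]
    refine (summable_sigmaTerm ?_ ?_ hε).mul_left _
    · push_cast
      linarith [(Nat.cast_nonneg j₁ : (0 : ℝ) ≤ j₁)]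
    · positivity
  unfold U19
  rw [Summable.tsum_finsetSum fun j₀ _ => summable_sum fun j₁ _ => summable_sum fun j₂ _ =>
    hs j₀ j₁ j₂]
  refine Finset.sum_congr rfl fun j₀ _ => ?_
  rw [Summable.tsum_finsetSum fun j₁ _ => summable_sum fun j₂ _ => hs j₀ j₁ j₂]
  refine Finset.sum_congr rfl fun j₁ _ => ?_
  rw [Summable.tsum_finsetSum fun j₂ _ => hs j₀ j₁ j₂]
  refine Finset.sum_congr rfl fun j₂ _ => ?_
  simp only [T19_eq]
  rw [tsum_mul_left]

lemma hasDerivAt_U19 (N : ℕ) :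
    HasDerivAt (fun ε : ℝ => U19 ε N)
      (∑ j₀ ∈ Finset.range (N - 2), ∑ j₁ ∈ Finset.range (N - j₀ - 2),
        ∑ j₂ ∈ Finset.range (j₀ + 2),
          constFactor N j₀ j₁ j₂ * (poch 3 j₁ / poch 4 (j₁ + j₂)) * epsCoeff j₁ (j₁ + j₂)) 0 := by
  have hI : Set.Icc (-1 : ℝ) 1 ∈ nhds (0 : ℝ) := Icc_mem_nhds (by norm_num) (by norm_num)
  have hev : (fun ε : ℝ => U19 ε N) =ᶠ[nhds 0] fun ε => _ :=
    Filter.mem_of_superset hI fun ε hε => U19_eq hε N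
  refine HasDerivAt.congr_of_eventuallyEq ?_ hev
  refine HasDerivAt.fun_sum fun j₀ _ => HasDerivAt.fun_sum fun j₁ _ =>
    HasDerivAt.fun_sum fun j₂ _ => ?_
  have h1 := (hasDerivAt_poch_div j₁ (j₁ + j₂)).const_mul (constFactor N j₀ j₁ j₂)
  have h2 := hasDerivAt_tsum_sigmaTerm_nat (j₁ + 3) (j₁ + j₂ + 3) (by omega) (by omega)
  refine (h1.fun_mul h2).congr_deriv ?_
  have hx : (4 : ℝ) ≤ ((j₁ + 3 : ℕ) : ℝ) + 1 := by
    push_cast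
    linarith [(Nat.cast_nonneg j₁ : (0 : ℝ) ≤ j₁)]
  rw [tsum_sigmaTerm hx (by positivity) (mem_of_mem_nhds hI), epsCoeff]
  simp only [zero_div, sub_zero]
  ring

lemma constFactor_mul (k j₀ j₁ j₂ : ℕ) (h₀ : j₀ < k + 1) :
    constFactor (k + 3) j₀ j₁ j₂ * (poch 3 j₁ / poch 4 (j₁ + j₂)) * epsCoeff j₁ (j₁ + j₂) =
      3 * (-1 : ℝ) ^ (k + 3) *
        (((j₀ + 1).choose j₂ : ℝ) * ((k - j₀).choose j₁ : ℝ) * ((k - j₀ + 1 : ℕ) : ℝ) *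
          (((j₁ + j₂ + 1).factorial : ℝ) * ((k + 1 - (j₁ + j₂)).factorial : ℝ) /
            (((k + 3).factorial : ℝ) * ((j₁ : ℝ) + j₂ + 3) * ((j₁ : ℝ) + 3)) *
              epsCoeff j₁ (j₁ + j₂))) := by
  have e1 := poch_nat 2 j₁
  have e2 := poch_nat 3 (j₁ + j₂)
  norm_num only [Nat.cast_ofNat, show Nat.factorial 3 = 6 from rfl,
    show Nat.factorial 2 = 2 from rfl] at e1 e2
  unfold constFactor
  rw [e1, e2, show k + 3 - j₀ - 3 = k - j₀ by omega, show k + 3 - j₀ - 2 = k - j₀ + 1 by omega,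
    show k + 3 - j₁ - j₂ - 2 = k + 1 - (j₁ + j₂) by omega, Nat.factorial_succ (k - j₀),
    Nat.factorial_succ (j₁ + 2), add_comm 2 j₁, show 3 + (j₁ + j₂) = j₁ + j₂ + 2 + 1 by ring,
    Nat.factorial_succ (j₁ + j₂ + 2)]
  have f1 : ((k - j₀).factorial : ℝ) ≠ 0 := by positivity
  have f2 : ((j₁ + 2).factorial : ℝ) ≠ 0 := by positivity
  have f3 : ((j₁ + j₂ + 2).factorial : ℝ) ≠ 0 := by positivity
  have f4 : ((k + 3).factorial : ℝ) ≠ 0 := by positivity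
  have f5 : (j₁ : ℝ) + 3 ≠ 0 := by positivity
  have f6 : (j₁ : ℝ) + j₂ + 3 ≠ 0 := by positivity
  rw [Nat.cast_mul (j₁ + 2 + 1), Nat.cast_mul (j₁ + j₂ + 2 + 1), Nat.cast_mul (k - j₀ + 1)]
  have g5 : ((j₁ + 2 + 1 : ℕ) : ℝ) = j₁ + 3 := by push_cast; ring
  have g6 : ((j₁ + j₂ + 2 + 1 : ℕ) : ℝ) = j₁ + j₂ + 3 := by push_cast; ring
  rw [g5, g6]
  field_simp
  ring

lemma sum_constFactor_mul (k : ℕ) :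
    ∑ j₀ ∈ Finset.range (k + 3 - 2), ∑ j₁ ∈ Finset.range (k + 3 - j₀ - 2),
        ∑ j₂ ∈ Finset.range (j₀ + 2),
          constFactor (k + 3) j₀ j₁ j₂ * (poch 3 j₁ / poch 4 (j₁ + j₂)) *
            epsCoeff j₁ (j₁ + j₂) =
      3 * (-1 : ℝ) ^ (k + 3) *
        (∑ m ∈ Finset.range (k + 2), 1 / (((m : ℝ) + 2) * ((m : ℝ) + 3)) *
          ∑ j ∈ Finset.range (m + 1), ((j : ℝ) + 1) / ((j : ℝ) + 3) * epsCoeff j m -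
        1 / ((k : ℝ) + 3) *
          ∑ m ∈ Finset.range (k + 2), ((m : ℝ) + 1) / ((m : ℝ) + 3) ^ 2 * epsCoeff m m) := by
  rw [← sum_double_eq_triangle_sub_diag, ← sum_triple_eq_sum_double, Finset.mul_sum]
  refine Finset.sum_congr rfl fun j₀ hj₀ => ?_
  rw [Finset.mul_sum, show k + 3 - j₀ - 2 = k + 1 - j₀ by omega]
  refine Finset.sum_congr rfl fun j₁ _ => ?_
  rw [Finset.mul_sum]
  exact Finset.sum_congr rfl fun j₂ _ => constFactor_mul k j₀ j₁ j₂ (Finset.mem_range.1 hj₀)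

/-- The linear coefficient of the ε-expansion of the multi-sum (Ex-857), as the
derivative at `ε = 0`; here `ζ(2) = π²/6`. -/
theorem stmt_19 (N : ℕ) (hN : 3 ≤ N) :
    HasDerivAt (fun ε : ℝ => U19 ε N)
      ((Real.pi ^ 2 / 6) *
          (-3 * (-1 : ℝ) ^ N * (4 * (N : ℝ) + 3) / (2 * (N : ℝ)) -
            3 * (-1 : ℝ) ^ N * (3 * (N : ℝ) + 2) * hS (-1) N / (N : ℝ) +
            9 / (2 * (N : ℝ))) +
        3 * (-1 : ℝ) ^ N * hS 1 N ^ 2 / (2 * ((N : ℝ) + 1)) +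
        (-1 : ℝ) ^ N *
            (2 * (N : ℝ) ^ 4 + 34 * (N : ℝ) ^ 3 + 101 * (N : ℝ) ^ 2 + 89 * (N : ℝ) + 2) *
            hS 1 N / (2 * (N : ℝ) * ((N : ℝ) + 1) ^ 2 * ((N : ℝ) + 2)) +
        3 * (-1 : ℝ) ^ N * (4 * (N : ℝ) ^ 2 + 14 * (N : ℝ) + 13) /
          (((N : ℝ) + 1) * ((N : ℝ) + 2)) +
        (-1 : ℝ) ^ N * (-30 * (N : ℝ) ^ 2 - 38 * (N : ℝ) + 1) * hS 2 N /
          (2 * (N : ℝ) * ((N : ℝ) + 1)) -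
        9 * (-1 : ℝ) ^ N * (2 * (N : ℝ) + 1) * hS 3 N / (N : ℝ) +
        9 * hS (-2) N / (N : ℝ) +
        9 * (-1 : ℝ) ^ N * hS21 N -
        6 * (-1 : ℝ) ^ N * (3 * (N : ℝ) + 2) * hS (-2) N * hS (-1) N / (N : ℝ) +
        6 * (-1 : ℝ) ^ N * (3 * (N : ℝ) + 2) * hSm2m1 N / (N : ℝ)) 0 := by
  obtain ⟨k, rfl⟩ := Nat.exists_eq_add_of_le' hN
  refine (hasDerivAt_U19 (k + 3)).congr_deriv ?_
  rw [sum_constFactor_mul, sum_epsCoeff_triangle, sum_epsCoeff_diag]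
  simp only [show k + 2 + 1 = k + 3 by ring]
  have hs := neg_one_pow_mul_self (k + 3)
  generalize (-1 : ℝ) ^ (k + 3) = s at *
  generalize hS 1 (k + 3) = a1
  generalize hS 2 (k + 3) = a2
  generalize hS 3 (k + 3) = a3
  generalize hS (-1) (k + 3) = b1
  generalize hS (-2) (k + 3) = b2
  generalize hS21 (k + 3) = c1
  generalize hSm2m1 (k + 3) = c2
  generalize Real.pi ^ 2 / 6 = z
  push_cast
  have e3 : (k : ℝ) + 2 + 1 = k + 3 := by ring
  have e4 : (k : ℝ) + 2 + 2 = k + 4 := by ring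
  have e5 : (k : ℝ) + 2 + 3 = k + 5 := by ring
  have e4' : (k : ℝ) + 3 + 1 = k + 4 := by ring
  have e5' : (k : ℝ) + 3 + 2 = k + 5 := by ring
  simp only [e3, e4, e5, e4', e5']
  have h3 : (k : ℝ) + 3 ≠ 0 := by positivity
  have h4 : (k : ℝ) + 4 ≠ 0 := by positivity
  have h5 : (k : ℝ) + 5 ≠ 0 := by positivity
  have hs' : s ^ 2 = 1 := by rw [sq, hs]
  field_simp
  ring_nf
  simp only [hs']
  ring
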